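/- Let i be an integer with 0 ≤ i ≤ N/2. Then the dimension of the eigenspace of A for the eigenvalue θ_i equals ∑_{ℓ=0}^{i} μ_{2ℓ} · binom(N−2ℓ, i−ℓ)_q. -/

import Mathlib

open Module Matrix Finset

noncomputable section

open scoped Classical

variable {F H : Type} [Field F] [Fintype F] [AddCommGroup H] [Module F H]
  [FiniteDimensional F H]

/-- The vertex set of the Attenuated Space poset `A_q(N,M)`:
the subspaces of `H` that intersect `h` trivially. -/
def AttX (h : Submodule F H) := {y : Submodule F H // y ⊓ h = ⊥}

instance (h : Submodule F H) : Fintype (AttX h) := by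
  have : Finite H := Module.finite_of_finite F
  have : Finite (Submodule F H) :=
    Finite.of_injective (fun y : Submodule F H => (y : Set H)) SetLike.coe_injective
  have : Finite (AttX h) := Subtype.finite
  exact Fintype.ofFinite _

/-- The dimension of a vertex. -/
def vdim (h : Submodule F H) (y : AttX h) : ℕ := finrank F (y.1 : Submodule F H)

/-- `AttCovers h y z` means that `z` covers `y`: `y ⊆ z` and `dim z = dim y + 1`. -/
def AttCovers (h : Submodule F H) (y z : AttX h) : Prop :=
  y.1 ≤ z.1 ∧ vdim h z = vdim h y + 1

/-- The `q`-integer `[n]_q = (q^n - 1)/(q - 1)`. -/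
def qInt (q n : ℕ) : ℕ := (q ^ n - 1) / (q - 1)

/-- The `q`-factorial `[n]_q!`. -/
def qFact (q : ℕ) : ℕ → ℕ
  | 0 => 1
  | n + 1 => qInt q (n + 1) * qFact q n

/-- The Gaussian binomial coefficient `binom(n,i)_q`. -/
def qBinom (q n i : ℕ) : ℕ := qFact q n / (qFact q i * qFact q (n - i))

/-- The raising matrix `R`: `(y,z)`-entry `1` if `y` covers `z`, else `0`. -/
def Rmat (h : Submodule F H) : Matrix (AttX h) (AttX h) ℂ :=
  fun y z => if AttCovers h z y then 1 else 0

/-- The lowering matrix `L'`: `(y,z)`-entry `1` if `z` covers `y`, else `0`. -/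
def Lpmat (h : Submodule F H) : Matrix (AttX h) (AttX h) ℂ :=
  fun y z => if AttCovers h y z then 1 else 0

/-- The `q`-lowering matrix `L`: `(y,z)`-entry `q^(dim y)` if `z` covers `y`, else `0`. -/
def Lmat (h : Submodule F H) (q : ℕ) : Matrix (AttX h) (AttX h) ℂ :=
  fun y z => if AttCovers h y z then (q : ℂ) ^ (vdim h y) else 0

/-- The `q`-adjacency matrix `A`: `(y,z)`-entry `1` if `y` covers `z`,
`q^(dim y)` if `z` covers `y`, and `0` otherwise. -/
def Amat (h : Submodule F H) (q : ℕ) : Matrix (AttX h) (AttX h) ℂ :=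
  fun y z =>
    if AttCovers h z y then 1 else if AttCovers h y z then (q : ℂ) ^ (vdim h y) else 0

/-- The dual adjacency matrix `A*`: diagonal with `(y,y)`-entry `q^{-dim y}`. -/
def Astar (h : Submodule F H) (q : ℕ) : Matrix (AttX h) (AttX h) ℂ :=
  Matrix.diagonal fun y => (q : ℂ) ^ (-(vdim h y : ℤ))

/-- The matrix `S`: diagonal with `(y,y)`-entry `(-1)^(dim y)`. -/
def Smat (h : Submodule F H) : Matrix (AttX h) (AttX h) ℂ :=
  Matrix.diagonal fun y => (-1 : ℂ) ^ (vdim h y)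

/-- The matrix `E*_i`: diagonal with `(y,y)`-entry `1` if `dim y = i`, else `0`. -/
def Estar (h : Submodule F H) (i : ℕ) : Matrix (AttX h) (AttX h) ℂ :=
  Matrix.diagonal fun y => if vdim h y = i then (1 : ℂ) else 0

/-- The eigenvalue `θ_i` for `i = k/2 ∈ [N] = {0, 1/2, 1, …, N}` (so `k = 0,…,2N`):
`θ_i = (q^(N-i) - q^i)/(q - 1) · q^(M/2)`, written via `√q`. -/
def theta (q N M k : ℕ) : ℝ :=
  (Real.sqrt q ^ (2 * N - k) - Real.sqrt q ^ k) / ((q : ℝ) - 1) * Real.sqrt q ^ M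

/-- The eigenspace of the `q`-adjacency matrix `A` for the eigenvalue `θ_{k/2}`. -/
def eigA (h : Submodule F H) (q N M k : ℕ) : Submodule ℂ (AttX h → ℂ) :=
  Module.End.eigenspace (Matrix.toLin' (Amat h q)) ((theta q N M k : ℝ) : ℂ)

/-- The multiplicity scalar `μ_r = binom(N,r)_q binom(M,r)_q (q^r-1)(q^r-q)⋯(q^r-q^(r-1))`. -/
def muMult (q N M r : ℕ) : ℕ :=
  qBinom q N r * qBinom q M r * ∏ j ∈ Finset.range r, (q ^ r - q ^ j)

theorem finrank_comap_mkQ {K V : Type} [Field K] [AddCommGroup V] [Module K V]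
    [FiniteDimensional K V] (A : Submodule K V) (U : Submodule K (V ⧸ A)) :
    finrank K (U.comap A.mkQ) = finrank K U + finrank K A := by
  have h := LinearMap.finrank_range_add_finrank_ker (A.mkQ.domRestrict (U.comap A.mkQ))
  have h1 : LinearMap.range (A.mkQ.domRestrict (U.comap A.mkQ)) = U := by
    rw [LinearMap.range_domRestrict, Submodule.map_comap_eq_of_surjective A.mkQ_surjective]
  have h2 : finrank K (LinearMap.ker (A.mkQ.domRestrict (U.comap A.mkQ))) = finrank K A := by
    rw [LinearMap.ker_domRestrict, Submodule.ker_mkQ]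
    exact (Submodule.submoduleOfEquivOfLe (by
      intro x hx
      rw [Submodule.mem_comap, Submodule.mkQ_apply, (Submodule.Quotient.mk_eq_zero A).2 hx]
      exact U.zero_mem)).finrank_eq
  rw [h1, h2] at h
  exact h.symm

section Counting

set_option linter.unusedSectionVars false

variable {K V W : Type} [Field K] [Fintype K] [AddCommGroup V] [Module K V] [Finite V]
  [AddCommGroup W] [Module K W] [Finite W]

local instance fintypeSubmodule : Fintype (Submodule K V) :=
  have : Finite (Submodule K V) :=
    Finite.of_injective (fun y : Submodule K V => (y : Set V)) SetLike.coe_injective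
  Fintype.ofFinite _

local instance fintypeLinearMap : Fintype (V →ₗ[K] W) :=
  have : Finite (V →ₗ[K] W) := DFunLike.finite _
  Fintype.ofFinite _

/-- The number of linear maps with a prescribed kernel. -/
theorem card_linearMap_ker_eq (L : Submodule K V) :
    Fintype.card {g : V →ₗ[K] W // LinearMap.ker g = L} =
      ∏ t ∈ Finset.range (finrank K (V ⧸ L)),
        (Fintype.card K ^ finrank K W - Fintype.card K ^ t) := by
  set d := finrank K (V ⧸ L) with hd
  let b : Basis (Fin d) K (V ⧸ L) := Module.finBasis K (V ⧸ L)
  have key : ∀ s : Fin d → W, LinearMap.ker ((b.constr K s).comp L.mkQ) = L ↔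
      LinearIndependent K s := by
    intro s
    have hs : (fun i => b.constr K s (b i)) = s := by ext i; simp
    rw [LinearMap.ker_comp]
    constructor
    · intro h
      have h0 : LinearMap.ker (b.constr K s) = ⊥ := by
        apply Submodule.comap_injective_of_surjective L.mkQ_surjective
        rw [h, Submodule.comap_bot, Submodule.ker_mkQ]
      have := b.linearIndependent.map' _ h0
      rwa [show (b.constr K s) ∘ b = s from hs] at this
    · intro h
      have h0 : LinearMap.ker (b.constr K s) = ⊥ := by
        have hc : b.constr K s = (Finsupp.linearCombination K s).comp b.repr.toLinearMap :=
          b.ext fun i => by simp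
        rw [LinearMap.ker_eq_bot, hc]
        exact (show Function.Injective (Finsupp.linearCombination K s) from h).comp b.repr.injective
      rw [h0, Submodule.comap_bot, Submodule.ker_mkQ]
  have hcard : Fintype.card {g : V →ₗ[K] W // LinearMap.ker g = L} =
      Nat.card {s : Fin d → W // LinearIndependent K s} := by
    rw [← Nat.card_eq_fintype_card]
    symm
    refine Nat.card_eq_of_bijective
      (fun s => ⟨(b.constr K s.1).comp L.mkQ, (key s.1).2 s.2⟩) ⟨?_, ?_⟩
    · intro s s' h
      have h1 := congrArg Subtype.val h
      simp only at h1
      have h2 := LinearMap.cancel_right L.mkQ_surjective |>.1 h1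
      exact Subtype.ext ((b.constr K).injective h2)
    · rintro ⟨g, hg⟩
      have h1 : (b.constr K (fun i => L.liftQ g hg.ge (b i))).comp L.mkQ = g := by
        have : b.constr K (fun i => L.liftQ g hg.ge (b i)) = L.liftQ g hg.ge :=
          b.ext fun i => by simp
        rw [this, Submodule.liftQ_mkQ]
      exact ⟨⟨fun i => L.liftQ g hg.ge (b i), (key _).1 (by rw [h1, hg])⟩, Subtype.ext h1⟩
  rw [hcard]
  by_cases hle : d ≤ finrank K W
  · rw [card_linearIndependent hle, Fin.prod_univ_eq_prod_range
      (fun i => Fintype.card K ^ finrank K W - Fintype.card K ^ i)]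
  · rw [Finset.prod_eq_zero (i := finrank K W) (by simpa using hle) (by simp)]
    have : IsEmpty {s : Fin d → W // LinearIndependent K s} :=
      ⟨fun s => hle (by simpa using s.2.fintype_card_le_finrank)⟩
    simp

theorem card_submodule_mul_prod (k : ℕ) (hk : k ≤ finrank K V) :
    Fintype.card {U : Submodule K V // finrank K U = k} *
      ∏ t ∈ Finset.range k, (Fintype.card K ^ k - Fintype.card K ^ t) =
    ∏ t ∈ Finset.range k, (Fintype.card K ^ finrank K V - Fintype.card K ^ t) := by
  have h1 := card_linearIndependent (K := K) hk
  rw [Fin.prod_univ_eq_prod_range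
      (fun i => Fintype.card K ^ finrank K V - Fintype.card K ^ i)] at h1
  rw [← h1]
  let S := {s : Fin k → V // LinearIndependent K s}
  have : Fintype S := Fintype.ofFinite _
  rw [Nat.card_eq_fintype_card]
  let f : S → {U : Submodule K V // finrank K U = k} := fun s =>
    ⟨Submodule.span K (Set.range s.1), by rw [finrank_span_eq_card s.2, Fintype.card_fin]⟩
  rw [← Fintype.card_congr (Equiv.sigmaFiberEquiv f), Fintype.card_sigma, ← smul_eq_mul,
    ← Finset.card_univ, ← Finset.sum_const]
  refine Finset.sum_congr rfl fun U _ => ?_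
  have hU := card_linearIndependent (K := K) (V := U.1) (k := k) U.2.ge
  rw [U.2, Fin.prod_univ_eq_prod_range
      (fun i => Fintype.card K ^ k - Fintype.card K ^ i)] at hU
  rw [← hU, ← Nat.card_eq_fintype_card]
  refine Nat.card_eq_of_bijective (fun s => ⟨⟨fun i => (s.1 i : V), s.2.map' U.1.subtype
    U.1.ker_subtype⟩, ?_⟩) ⟨?_, ?_⟩
  · apply Subtype.ext
    apply Submodule.eq_of_le_of_finrank_eq
    · rw [Submodule.span_le]
      rintro _ ⟨i, rfl⟩
      exact (s.1 i).2
    · rw [U.2]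
      exact (f _).2
  · intro s s' h
    have h1 := congrArg (fun z => z.1.1) h
    apply Subtype.ext
    funext i
    exact Subtype.ext (congrFun h1 i)
  · rintro ⟨⟨s, hs⟩, hsU⟩
    have hmem : ∀ i, s i ∈ U.1 := fun i => by
      have : Submodule.span K (Set.range s) = U.1 := congrArg Subtype.val hsU
      rw [← this]
      exact Submodule.subset_span ⟨i, rfl⟩
    refine ⟨⟨fun i => ⟨s i, hmem i⟩, ?_⟩, rfl⟩
    exact LinearIndependent.of_comp U.1.subtype hs

theorem qInt_mul_pred (q n : ℕ) : qInt q n * (q - 1) = q ^ n - 1 :=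
  Nat.div_mul_cancel (by simpa using Nat.sub_dvd_pow_sub_pow q 1 n)

theorem qInt_pos {q : ℕ} (hq : 1 < q) {n : ℕ} (hn : 0 < n) : 0 < qInt q n := by
  have h := qInt_mul_pred q n
  have : 1 < q ^ n := Nat.one_lt_pow hn.ne' hq
  rcases Nat.eq_zero_or_pos (qInt q n) with h0 | h0
  · rw [h0] at h; omega
  · exact h0

theorem qFact_pos {q : ℕ} (hq : 1 < q) (n : ℕ) : 0 < qFact q n := by
  induction n with
  | zero => simp [qFact]
  | succ n ih => exact Nat.mul_pos (qInt_pos hq n.succ_pos) ih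

theorem prod_pow_sub_mul_qFact {q : ℕ} (n k : ℕ) (hk : k ≤ n) :
    (∏ t ∈ Finset.range k, (q ^ n - q ^ t)) * qFact q (n - k) =
      (∏ t ∈ Finset.range k, q ^ t) * (q - 1) ^ k * qFact q n := by
  induction k with
  | zero => simp
  | succ k ih =>
    rw [Finset.prod_range_succ, Finset.prod_range_succ]
    have h1 : q ^ n - q ^ k = q ^ k * (qInt q (n - k) * (q - 1)) := by
      rw [qInt_mul_pred, Nat.mul_sub, ← pow_add, Nat.add_sub_cancel' (by omega), mul_one]
    have h2 : qFact q (n - k) = qInt q (n - k) * qFact q (n - (k + 1)) := by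
      obtain ⟨m, hm⟩ : ∃ m, n - k = m + 1 := ⟨n - k - 1, by omega⟩
      rw [show n - (k + 1) = m by omega, hm, qFact]
    have ih' := ih (by omega)
    rw [h2] at ih'
    rw [h1, pow_succ]
    linear_combination (q ^ k * (q - 1)) * ih'

/-- The number of `k`-dimensional subspaces is a Gaussian binomial coefficient. -/
theorem card_submodule_finrank_eq (k : ℕ) (hk : k ≤ finrank K V) :
    Fintype.card {U : Submodule K V // finrank K U = k} =
      qBinom (Fintype.card K) (finrank K V) k := by
  have hq : 1 < Fintype.card K := Fintype.one_lt_card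
  set q := Fintype.card K
  set n := finrank K V
  set G := Fintype.card {U : Submodule K V // finrank K U = k}
  have h := card_submodule_mul_prod (K := K) (V := V) k hk
  have h1 := prod_pow_sub_mul_qFact (q := q) n k hk
  have h2 := prod_pow_sub_mul_qFact (q := q) k k le_rfl
  rw [Nat.sub_self] at h2
  simp only [qFact, mul_one] at h2
  have hc : 0 < (∏ t ∈ Finset.range k, q ^ t) * (q - 1) ^ k :=
    Nat.mul_pos (Finset.prod_pos fun t _ => by positivity)
      (pow_pos (by omega) k)
  have h3 : G * (qFact q k * qFact q (n - k)) = qFact q n := by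
    apply Nat.eq_of_mul_eq_mul_left hc
    rw [← h1, ← h, h2]
    ring
  rw [qBinom, ← h3, Nat.mul_div_cancel _ (Nat.mul_pos (qFact_pos hq _) (qFact_pos hq _))]

theorem qBinom_one {q : ℕ} (hq : 1 < q) {n : ℕ} (hn : 0 < n) : qBinom q n 1 = qInt q n := by
  obtain ⟨m, rfl⟩ : ∃ m, n = m + 1 := ⟨n - 1, by omega⟩
  have h1 : qInt q 1 = 1 := by
    rw [qInt, pow_one]
    exact Nat.div_self (by omega)
  simp only [qBinom, qFact, h1, mul_one, one_mul, Nat.add_sub_cancel]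
  exact Nat.mul_div_cancel _ (qFact_pos hq m)

theorem qBinom_symm (q : ℕ) {n k : ℕ} (hk : k ≤ n) : qBinom q n (n - k) = qBinom q n k := by
  rw [qBinom, qBinom, Nat.sub_sub_self hk, mul_comm]

/-- The number of subspaces of a given dimension in an interval. -/
theorem card_Icc_finrank_eq {A B : Submodule K V} (hAB : A ≤ B) (d : ℕ)
    (hd : d ≤ finrank K B - finrank K A) :
    Fintype.card {Z : Submodule K V // (A ≤ Z ∧ Z ≤ B) ∧ finrank K Z = finrank K A + d} =
      qBinom (Fintype.card K) (finrank K B - finrank K A) d := by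
  have hA : finrank K (A.submoduleOf B) = finrank K A :=
    (Submodule.submoduleOfEquivOfLe hAB).finrank_eq
  have hq : finrank K (B ⧸ A.submoduleOf B) = finrank K B - finrank K A := by
    rw [Submodule.finrank_quotient, hA]
  have hfin : Finite (B ⧸ A.submoduleOf B) := Module.finite_of_finite K
  rw [← hq] at hd ⊢
  rw [← card_submodule_finrank_eq d hd, ← Nat.card_eq_fintype_card, ← Nat.card_eq_fintype_card]
  symm
  have hfr : ∀ U : Submodule K (B ⧸ A.submoduleOf B),
      finrank K ((U.comap (A.submoduleOf B).mkQ).map B.subtype) = finrank K U + finrank K A := by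
    intro U
    rw [Submodule.finrank_map_subtype_eq, finrank_comap_mkQ, hA]
  refine Nat.card_eq_of_bijective
    (fun U => ⟨(U.1.comap (A.submoduleOf B).mkQ).map B.subtype,
      ⟨?_, Submodule.map_subtype_le _ _⟩, by rw [hfr, U.2, add_comm]⟩) ⟨?_, ?_⟩
  · intro x hx
    refine ⟨⟨x, hAB hx⟩, ?_, rfl⟩
    have : (A.submoduleOf B).mkQ ⟨x, hAB hx⟩ = 0 := by
      rw [Submodule.mkQ_apply, Submodule.Quotient.mk_eq_zero]
      exact hx
    change (A.submoduleOf B).mkQ ⟨x, hAB hx⟩ ∈ U.1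
    rw [this]
    exact U.1.zero_mem
  · intro U U' h
    have h1 := Submodule.map_injective_of_injective B.injective_subtype (congrArg Subtype.val h)
    exact Subtype.ext (Submodule.comap_injective_of_surjective (Submodule.mkQ_surjective _) h1)
  · rintro ⟨Z, ⟨hAZ, hZB⟩, hZ⟩
    have hback : (((Z.comap B.subtype).map (A.submoduleOf B).mkQ).comap
        (A.submoduleOf B).mkQ).map B.subtype = Z := by
      rw [Submodule.comap_map_mkQ, sup_eq_right.2 (Submodule.comap_mono hAZ),
        Submodule.map_comap_subtype, inf_eq_right.2 hZB]
    refine ⟨⟨(Z.comap B.subtype).map (A.submoduleOf B).mkQ, ?_⟩, Subtype.ext hback⟩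
    have := hfr ((Z.comap B.subtype).map (A.submoduleOf B).mkQ)
    rw [hback] at this
    omega

/-- The number of covers of `A` inside `B`. -/
theorem card_covers_mul {A B : Submodule K V} (hAB : A ≤ B) :
    (#{Z : Submodule K V | (A ≤ Z ∧ Z ≤ B) ∧ finrank K Z = finrank K A + 1} : ℂ) *
      ((Fintype.card K : ℂ) - 1) =
      (Fintype.card K : ℂ) ^ (finrank K B - finrank K A) - 1 := by
  have hq : 1 < Fintype.card K := Fintype.one_lt_card
  rw [← Fintype.card_subtype]
  have hle := Submodule.finrank_mono hAB
  rcases hle.eq_or_lt with h | h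
  · have : IsEmpty {Z : Submodule K V // (A ≤ Z ∧ Z ≤ B) ∧ finrank K Z = finrank K A + 1} :=
      ⟨fun Z => by have := Submodule.finrank_mono Z.2.1.2; have := Z.2.2; omega⟩
    rw [Fintype.card_eq_zero, h, Nat.sub_self]
    simp
  · rw [card_Icc_finrank_eq hAB 1 (by omega), qBinom_one hq (by omega)]
    have := qInt_mul_pred (Fintype.card K) (finrank K B - finrank K A)
    have h2 := congrArg (Nat.cast : ℕ → ℂ) this
    rw [Nat.cast_mul, Nat.cast_sub hq.le, Nat.cast_sub (Nat.one_le_pow _ _ (by omega))] at h2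
    simpa using h2

/-- The number of subspaces covered by `B` which contain `A`. -/
theorem card_covered_mul {A B : Submodule K V} (hAB : A ≤ B) :
    (#{Z : Submodule K V | (A ≤ Z ∧ Z ≤ B) ∧ finrank K B = finrank K Z + 1} : ℂ) *
      ((Fintype.card K : ℂ) - 1) =
      (Fintype.card K : ℂ) ^ (finrank K B - finrank K A) - 1 := by
  have hq : 1 < Fintype.card K := Fintype.one_lt_card
  rw [← Fintype.card_subtype]
  have hle := Submodule.finrank_mono hAB
  rcases hle.eq_or_lt with h | h
  · have : IsEmpty {Z : Submodule K V // (A ≤ Z ∧ Z ≤ B) ∧ finrank K B = finrank K Z + 1} :=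
      ⟨fun Z => by have := Submodule.finrank_mono Z.2.1.1; have := Z.2.2; omega⟩
    rw [Fintype.card_eq_zero, h, Nat.sub_self]
    simp
  · have hc : Fintype.card
        {Z : Submodule K V // (A ≤ Z ∧ Z ≤ B) ∧ finrank K B = finrank K Z + 1} =
        Fintype.card {Z : Submodule K V // (A ≤ Z ∧ Z ≤ B) ∧
          finrank K Z = finrank K A + (finrank K B - finrank K A - 1)} :=
      Fintype.card_congr (Equiv.subtypeEquivRight fun Z => and_congr_right fun _ => by omega)
    rw [hc, card_Icc_finrank_eq hAB _ (by omega), qBinom_symm _ (by omega),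
      qBinom_one hq (by omega)]
    have := qInt_mul_pred (Fintype.card K) (finrank K B - finrank K A)
    have h2 := congrArg (Nat.cast : ℕ → ℂ) this
    rw [Nat.cast_mul, Nat.cast_sub hq.le, Nat.cast_sub (Nat.one_le_pow _ _ (by omega))] at h2
    simpa using h2

theorem card_linearMap :
    Fintype.card (V →ₗ[K] W) = Fintype.card K ^ (finrank K V * finrank K W) := by
  rw [Module.card_eq_pow_finrank (K := K), Module.finrank_linearMap]

/-- The number of linear maps of a given rank. -/
theorem card_linearMap_finrank_range_eq (r : ℕ) (hrV : r ≤ finrank K V) (hrW : r ≤ finrank K W) :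
    Fintype.card {g : V →ₗ[K] W // finrank K (LinearMap.range g) = r} =
      qBinom (Fintype.card K) (finrank K W) r * qBinom (Fintype.card K) (finrank K V) r *
        ∏ t ∈ Finset.range r, (Fintype.card K ^ r - Fintype.card K ^ t) := by
  have h1 := card_submodule_mul_prod (K := K) (V := W) r hrW
  rw [card_submodule_finrank_eq r hrW] at h1
  rw [mul_right_comm, h1, ← qBinom_symm _ hrV, ← card_submodule_finrank_eq _ (Nat.sub_le _ _)]
  let f : {g : V →ₗ[K] W // finrank K (LinearMap.range g) = r} →
      {L : Submodule K V // finrank K L = finrank K V - r} := fun g =>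
    ⟨LinearMap.ker g.1, by have := LinearMap.finrank_range_add_finrank_ker g.1; omega⟩
  rw [← Fintype.card_congr (Equiv.sigmaFiberEquiv f), Fintype.card_sigma, mul_comm,
    ← smul_eq_mul, ← Finset.card_univ, ← Finset.sum_const]
  refine Finset.sum_congr rfl fun L _ => ?_
  have h2 := card_linearMap_ker_eq (W := W) L.1
  rw [Submodule.finrank_quotient, L.2, Nat.sub_sub_self hrV] at h2
  rw [← h2]
  refine Fintype.card_congr ((Equiv.subtypeSubtypeEquivSubtypeExists _ _).trans
    (Equiv.subtypeEquivRight fun g => ?_))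
  constructor
  · rintro ⟨_, h⟩
    exact congrArg Subtype.val h
  · intro h
    have h3 := LinearMap.finrank_range_add_finrank_ker g
    rw [h, L.2] at h3
    exact ⟨by omega, Subtype.ext h⟩

/-- A `q`-binomial theorem for the lattice of subspaces. -/
theorem sum_prod_sub_eq_pow {R : Type*} [CommRing R] [IsDomain R] [CharZero R] (x : R) :
    ∑ L : Submodule K V, ∏ t ∈ Finset.range (finrank K (V ⧸ L)),
      (x - (Fintype.card K : R) ^ t) = x ^ finrank K V := by
  have hq : 1 < Fintype.card K := Fintype.one_lt_card
  let P : Polynomial R := ∑ L : Submodule K V, ∏ t ∈ Finset.range (finrank K (V ⧸ L)),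
      (Polynomial.X - Polynomial.C ((Fintype.card K : R) ^ t))
  have hP : P = Polynomial.X ^ finrank K V := by
    have hinj : Function.Injective fun m : ℕ => (Fintype.card K : R) ^ m := by
      intro a b hab
      have : ((Fintype.card K ^ a : ℕ) : R) = ((Fintype.card K ^ b : ℕ) : R) := by
        push_cast
        exact hab
      exact Nat.pow_right_injective hq (Nat.cast_injective this)
    refine Polynomial.eq_of_infinite_eval_eq _ _
      ((Set.infinite_range_of_injective hinj).mono ?_)
    rintro _ ⟨m, rfl⟩
    have hcard : ∑ L : Submodule K V, Fintype.card {g : V →ₗ[K] (Fin m → K) //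
        LinearMap.ker g = L} = Fintype.card K ^ (finrank K V * m) := by
      rw [← Fintype.card_sigma, Fintype.card_congr (Equiv.sigmaFiberEquiv _), card_linearMap,
        finrank_fin_fun]
    have hcast := congrArg (Nat.cast : ℕ → R) hcard
    simp only [Set.mem_ofPred_eq, P, Polynomial.eval_finsetSum, Polynomial.eval_prod,
      Polynomial.eval_sub, Polynomial.eval_X, Polynomial.eval_C, Polynomial.eval_pow]
    rw [← pow_mul, mul_comm m]
    push_cast at hcast
    rw [← hcast]
    refine Finset.sum_congr rfl fun L _ => ?_
    rw [card_linearMap_ker_eq, finrank_fin_fun]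
    by_cases hm : finrank K (V ⧸ L) ≤ m
    · rw [Nat.cast_prod]
      refine Finset.prod_congr rfl fun t ht => ?_
      rw [Nat.cast_sub (Nat.pow_le_pow_right (by omega)
        ((Finset.mem_range.1 ht).le.trans hm))]
      push_cast
      rfl
    · rw [Finset.prod_eq_zero (i := m) (by simpa using hm) (by simp),
        Finset.prod_eq_zero (i := m) (by simpa using hm) (by simp), Nat.cast_zero]
  have := congrArg (Polynomial.eval x) hP
  simpa [P, Polynomial.eval_finsetSum, Polynomial.eval_prod] using this

local instance fintypeLinearPMap : Fintype (V →ₗ.[K] W) :=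
  have : Finite (V →ₗ.[K] W) := Finite.of_injective
    (fun p : V →ₗ.[K] W => (p.graph : Set (V × W)))
    (fun _ _ h => LinearPMap.eq_of_eq_graph (SetLike.coe_injective h))
  Fintype.ofFinite _

/-- A linear extension of a partially defined linear map to the whole space. -/
def totalExtension (p : V →ₗ.[K] W) : V →ₗ[K] W := Classical.choose p.toFun.exists_extend

theorem totalExtension_apply (p : V →ₗ.[K] W) (x : p.domain) : totalExtension p x = p x :=
  LinearMap.congr_fun (Classical.choose_spec p.toFun.exists_extend) x

/-- The function `p ↦ ψ (tr (p ∘ g))` on the partial linear maps defined on the range of `g`,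
extended by zero. -/
def phase (ψ : AddChar K ℂ) (g : W →ₗ[K] V) (p : V →ₗ.[K] W) : ℂ :=
  if LinearMap.range g ≤ p.domain then
    ψ (LinearMap.trace K W (totalExtension p ∘ₗ g)) else 0

variable {ψ : AddChar K ℂ} {g : W →ₗ[K] V} {p : V →ₗ.[K] W}

theorem phase_of_not_le (hg : ¬ LinearMap.range g ≤ p.domain) : phase ψ g p = 0 := if_neg hg

theorem phase_eq (hg : LinearMap.range g ≤ p.domain) (f : V →ₗ[K] W)
    (hf : ∀ x : p.domain, f x = p x) :
    phase ψ g p = ψ (LinearMap.trace K W (f ∘ₗ g)) := by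
  rw [phase, if_pos hg]
  congr 2
  ext x
  have hx : g x ∈ p.domain := hg ⟨x, rfl⟩
  exact (totalExtension_apply p ⟨g x, hx⟩).trans (hf ⟨g x, hx⟩).symm

theorem phase_of_le {p' : V →ₗ.[K] W} (hp : p ≤ p') (hg : LinearMap.range g ≤ p.domain) :
    phase ψ g p' = phase ψ g p := by
  rw [phase_eq (hg.trans hp.1) _ (totalExtension_apply p'),
    phase_eq hg (totalExtension p') fun x => ?_]
  exact (totalExtension_apply p' ⟨x, hp.1 x.2⟩).trans
    (@hp.2 x ⟨x, hp.1 x.2⟩ rfl).symm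

theorem phase_vadd (hg : LinearMap.range g ≤ p.domain) (f : V →ₗ[K] W) :
    phase ψ g (f +ᵥ p) = ψ (LinearMap.trace K W (f ∘ₗ g)) * phase ψ g p := by
  rw [phase_eq (p := f +ᵥ p) hg (f + totalExtension p) fun x => ?_,
    phase_eq hg _ (totalExtension_apply p), LinearMap.add_comp, map_add, AddChar.map_add_eq_mul]
  rw [LinearMap.add_apply, LinearPMap.vadd_apply, totalExtension_apply p x]

/-- Nondegeneracy of the trace pairing, relative to a subspace. -/
theorem exists_addChar_trace_ne_one (hψ : ψ ≠ 1) {D : Submodule K V}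
    (hg : ¬ LinearMap.range g ≤ D) :
    ∃ f : V →ₗ[K] W, (∀ x ∈ D, f x = 0) ∧ ψ (LinearMap.trace K W (f ∘ₗ g)) ≠ 1 := by
  obtain ⟨_, ⟨w, rfl⟩, hw⟩ := SetLike.not_le_iff_exists.1 hg
  obtain ⟨φ, hφw, hφD⟩ := Submodule.exists_le_ker_of_notMem hw
  obtain ⟨c, hc⟩ := (AddChar.ne_one_iff).1 hψ
  refine ⟨φ.smulRight ((c / φ (g w)) • w), fun x hx => ?_, ?_⟩
  · rw [LinearMap.smulRight_apply, show φ x = 0 from hφD hx, zero_smul]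
  · have : (φ.smulRight ((c / φ (g w)) • w)) ∘ₗ g = (φ ∘ₗ g).smulRight ((c / φ (g w)) • w) := rfl
    rw [this, LinearMap.trace_smulRight, LinearMap.comp_apply, map_smul, map_smul, smul_eq_mul,
      div_mul_cancel₀ _ hφw]
    exact hc

theorem sum_phase_extension_eq_zero (hψ : ψ ≠ 1) {Z : Submodule K V}
    (hgZ : LinearMap.range g ≤ Z) (hg : ¬ LinearMap.range g ≤ p.domain) :
    ∑ p' : V →ₗ.[K] W with p ≤ p' ∧ p'.domain = Z, phase ψ g p' = 0 := by
  obtain ⟨f, hfD, hf⟩ := exists_addChar_trace_ne_one hψ hg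
  have hmem : ∀ f : V →ₗ[K] W, (∀ x ∈ p.domain, f x = 0) → ∀ p' : V →ₗ.[K] W,
      p ≤ p' ∧ p'.domain = Z → p ≤ f +ᵥ p' ∧ (f +ᵥ p').domain = Z := by
    rintro f hfD p' ⟨h1, h2⟩
    refine ⟨⟨h1.1, fun x y hxy => ?_⟩, h2⟩
    rw [LinearPMap.vadd_apply, ← hxy, hfD x x.2, zero_add]
    exact h1.2 hxy
  have h : ∑ p' : V →ₗ.[K] W with p ≤ p' ∧ p'.domain = Z, phase ψ g p' =
      ψ (LinearMap.trace K W (f ∘ₗ g)) *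
        ∑ p' : V →ₗ.[K] W with p ≤ p' ∧ p'.domain = Z, phase ψ g p' := by
    rw [Finset.mul_sum]
    symm
    refine Finset.sum_bij' (fun p' _ => f +ᵥ p') (fun p' _ => (-f) +ᵥ p') ?_ ?_ ?_ ?_ ?_
    · intro p' hp'
      simpa using hmem f hfD p' (by simpa using hp')
    · intro p' hp'
      simpa using hmem (-f) (fun x hx => by rw [LinearMap.neg_apply, hfD x hx, neg_zero]) p'
        (by simpa using hp')
    · intro p' _
      simp
    · intro p' _
      simp
    · intro p' hp'
      rw [phase_vadd]
      rw [(Finset.mem_filter.1 hp').2.2]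
      exact hgZ
  have h2 : (1 - ψ (LinearMap.trace K W (f ∘ₗ g))) *
      ∑ p' : V →ₗ.[K] W with p ≤ p' ∧ p'.domain = Z, phase ψ g p' = 0 := by
    linear_combination h
  exact (mul_eq_zero.1 h2).resolve_left (sub_ne_zero.2 hf.symm)

/-- The number of extensions of a partial linear map to one more dimension. -/
theorem card_extension {Z : Submodule K V} (hZ : p.domain ≤ Z)
    (hdim : finrank K Z = finrank K p.domain + 1) :
    #{p' : V →ₗ.[K] W | p ≤ p' ∧ p'.domain = Z} = Fintype.card K ^ finrank K W := by
  obtain ⟨v, hvZ, hv⟩ := SetLike.exists_of_lt (lt_of_le_of_ne hZ fun h => by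
    rw [h] at hdim; omega)
  have hsup : p.domain ⊔ K ∙ v = Z := by
    apply Submodule.eq_of_le_of_finrank_le
    · exact sup_le hZ (by simpa using hvZ)
    · rw [hdim]
      exact Nat.succ_le_of_lt (Submodule.finrank_lt_finrank_of_lt (lt_of_le_of_ne le_sup_left
        fun h => hv (h ▸ (le_sup_right : K ∙ v ≤ _) (Submodule.mem_span_singleton_self v))))
  have := Fintype.ofFinite W
  rw [← Module.card_eq_pow_finrank, ← Finset.card_univ]
  symm
  refine Finset.card_bij (fun w _ => p.supSpanSingleton v w hv) ?_ ?_ ?_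
  · intro w _
    rw [Finset.mem_filter]
    exact ⟨Finset.mem_univ _, LinearPMap.left_le_sup _ _ _,
      (LinearPMap.domain_supSpanSingleton ..).trans hsup⟩
  · intro w _ w' _ h
    have hm : ∀ w, (v, w) ∈ (p.supSpanSingleton v w hv).graph := fun w => by
      rw [LinearPMap.mem_graph_iff]
      exact ⟨⟨v, _⟩, rfl, LinearPMap.supSpanSingleton_apply_self p w hv⟩
    have h1 := hm w
    rw [h] at h1
    exact LinearPMap.mem_graph_snd_inj _ h1 (hm w') rfl
  · intro p' hp'
    obtain ⟨-, hle, rfl⟩ := Finset.mem_filter.1 hp'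
    refine ⟨p' ⟨v, hvZ⟩, Finset.mem_univ _, ?_⟩
    refine LinearPMap.eq_of_le_of_domain_eq ?_ ((LinearPMap.domain_supSpanSingleton ..).trans hsup)
    apply LinearPMap.sup_le
    · exact hle
    · refine ⟨by simpa [LinearPMap.mkSpanSingleton] using hvZ, ?_⟩
      rintro ⟨x, hx⟩ y hxy
      obtain ⟨c, rfl⟩ := Submodule.mem_span_singleton.1 hx
      obtain rfl : y = c • ⟨v, hvZ⟩ := Subtype.ext hxy.symm
      rw [LinearPMap.map_smul]
      exact LinearPMap.mkSpanSingleton'_apply ..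

/-- The weight attached to the subspace `Z` by the eigenvector indexed by a subspace `U`. -/
def weight (y x : ℂ) (U Z : Submodule K V) : ℂ :=
  y ^ finrank K Z * x ^ finrank K (Z ⊓ U : Submodule K V)

theorem weight_of_covered {y x : ℂ} (hy : y ≠ 0) (hx : x ≠ 0) {U D Z : Submodule K V}
    (hZD : Z ≤ D) (hdim : finrank K D = finrank K Z + 1) :
    weight y x U Z = weight y x U D * y⁻¹ * (x⁻¹ + if D ⊓ U ≤ Z then 1 - x⁻¹ else 0) := by
  have hpow : y ^ finrank K Z = y ^ finrank K D * y⁻¹ := by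
    rw [hdim, pow_succ, mul_inv_cancel_right₀ hy]
  rw [weight, weight, hpow]
  split_ifs with h
  · have : Z ⊓ U = D ⊓ U := le_antisymm (inf_le_inf_right _ hZD) (le_inf h inf_le_right)
    rw [this]
    ring
  · have hlt : finrank K (Z ⊓ U : Submodule K V) < finrank K (D ⊓ U : Submodule K V) :=
      Submodule.finrank_lt_finrank_of_lt (lt_of_le_of_ne (inf_le_inf_right _ hZD)
        fun e => h (e ▸ inf_le_left))
    have h1 := Submodule.finrank_sup_add_finrank_inf_eq Z U
    have h2 := Submodule.finrank_sup_add_finrank_inf_eq D U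
    have h3 := Submodule.finrank_mono (sup_le_sup_right hZD U)
    have h4 : finrank K (D ⊓ U : Submodule K V) = finrank K (Z ⊓ U : Submodule K V) + 1 := by
      omega
    rw [h4, pow_succ]
    field_simp
    ring

theorem weight_of_cover {y x : ℂ} {U D Z : Submodule K V}
    (hDZ : D ≤ Z) (hdim : finrank K Z = finrank K D + 1) :
    weight y x U Z = weight y x U D * y * (1 + if Z ≤ D ⊔ U then x - 1 else 0) := by
  have h1 := Submodule.finrank_sup_add_finrank_inf_eq Z U
  have h2 := Submodule.finrank_sup_add_finrank_inf_eq D U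
  rw [weight, weight, hdim, pow_succ]
  split_ifs with h
  · have h3 : Z ⊔ U = D ⊔ U := le_antisymm (sup_le h le_sup_right) (sup_le_sup_right hDZ _)
    rw [h3] at h1
    have h4 : finrank K (Z ⊓ U : Submodule K V) = finrank K (D ⊓ U : Submodule K V) + 1 := by
      omega
    rw [h4, pow_succ]
    ring
  · have hlt : finrank K (D ⊔ U : Submodule K V) < finrank K (Z ⊔ U : Submodule K V) :=
      Submodule.finrank_lt_finrank_of_lt (lt_of_le_of_ne (sup_le_sup_right hDZ _)
        fun e => h (e ▸ le_sup_left))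
    have h3 := Submodule.finrank_mono (inf_le_inf_right U hDZ)
    have h4 : finrank K (Z ⊓ U : Submodule K V) = finrank K (D ⊓ U : Submodule K V) := by
      omega
    rw [h4]
    ring

/-- The eigenvalue equation for the weights on the interval above `A`. -/
theorem weight_eigen_equation {s : ℂ} (hs : s ^ 2 = Fintype.card K) {A U D : Submodule K V}
    (hAU : A ≤ U) (hAD : A ≤ D) (M : ℕ) {y x : ℂ}
    (hy : y = (s ^ (M + finrank K A) * (Fintype.card K : ℂ) ^ (finrank K U - finrank K A))⁻¹)
    (hx : x = -(Fintype.card K : ℂ) ^ (finrank K U - finrank K A)) :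
    ∑ Z : Submodule K V with (A ≤ Z ∧ Z ≤ D) ∧ finrank K D = finrank K Z + 1, weight y x U Z +
      (Fintype.card K : ℂ) ^ (finrank K D + M) *
        ∑ Z : Submodule K V with (D ≤ Z ∧ Z ≤ ⊤) ∧ finrank K Z = finrank K D + 1,
          weight y x U Z =
      (s ^ (2 * finrank K V - (2 * finrank K U - finrank K A)) -
        s ^ (2 * finrank K U - finrank K A)) / ((Fintype.card K : ℂ) - 1) * s ^ M *
        weight y x U D := by
  have hq1 : (Fintype.card K : ℂ) - 1 ≠ 0 := by
    have : (Fintype.card K : ℂ) ≠ 1 := by exact_mod_cast (Fintype.one_lt_card (α := K)).ne'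
    exact sub_ne_zero.2 this
  have hq0 : (Fintype.card K : ℂ) ≠ 0 := by exact_mod_cast Fintype.card_ne_zero
  have hs0 : s ≠ 0 := by
    rintro rfl
    simp at hs
    exact hq0 hs.symm
  have hy0 : y ≠ 0 := by
    rw [hy]
    exact inv_ne_zero (mul_ne_zero (pow_ne_zero _ hs0) (pow_ne_zero _ hq0))
  have hx0 : x ≠ 0 := by
    rw [hx]
    exact neg_ne_zero.2 (pow_ne_zero _ hq0)
  have hlow : ∑ Z : Submodule K V with (A ≤ Z ∧ Z ≤ D) ∧ finrank K D = finrank K Z + 1,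
      weight y x U Z = weight y x U D * y⁻¹ *
        (#{Z : Submodule K V | (A ≤ Z ∧ Z ≤ D) ∧ finrank K D = finrank K Z + 1} * x⁻¹ +
        #{Z : Submodule K V | (D ⊓ U ≤ Z ∧ Z ≤ D) ∧ finrank K D = finrank K Z + 1} *
          (1 - x⁻¹)) := by
    rw [Finset.sum_congr rfl fun Z hZ => weight_of_covered hy0 hx0
      (Finset.mem_filter.1 hZ).2.1.2 (Finset.mem_filter.1 hZ).2.2, ← Finset.mul_sum,
      Finset.sum_add_distrib, Finset.sum_const, nsmul_eq_mul, ← Finset.sum_filter,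
      Finset.sum_const, nsmul_eq_mul, Finset.filter_filter]
    congr 5
    refine Finset.filter_congr fun Z _ => ?_
    have := (le_inf hAD hAU : A ≤ D ⊓ U)
    exact ⟨fun h => ⟨⟨h.2, h.1.1.2⟩, h.1.2⟩, fun h => ⟨⟨⟨this.trans h.1.1, h.1.2⟩, h.2⟩, h.1.1⟩⟩
  have hup : ∑ Z : Submodule K V with (D ≤ Z ∧ Z ≤ ⊤) ∧ finrank K Z = finrank K D + 1,
      weight y x U Z = weight y x U D * y *
        (#{Z : Submodule K V | (D ≤ Z ∧ Z ≤ ⊤) ∧ finrank K Z = finrank K D + 1} +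
        #{Z : Submodule K V | (D ≤ Z ∧ Z ≤ D ⊔ U) ∧ finrank K Z = finrank K D + 1} *
          (x - 1)) := by
    rw [Finset.sum_congr rfl fun Z hZ => weight_of_cover
      (Finset.mem_filter.1 hZ).2.1.1 (Finset.mem_filter.1 hZ).2.2, ← Finset.mul_sum,
      Finset.sum_add_distrib, Finset.sum_const, nsmul_eq_mul, mul_one, ← Finset.sum_filter,
      Finset.sum_const, nsmul_eq_mul, Finset.filter_filter]
    congr 5
    refine Finset.filter_congr fun Z _ => ?_
    exact ⟨fun h => ⟨⟨h.1.1.1, h.2⟩, h.1.2⟩, fun h => ⟨⟨⟨h.1.1, le_top⟩, h.2⟩, h.1.2⟩⟩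
  have n0 := card_covered_mul hAD
  have n1 := card_covered_mul (inf_le_left : D ⊓ U ≤ D)
  have m0 := card_covers_mul (le_top : D ≤ ⊤)
  have m1 := card_covers_mul (le_sup_left : D ≤ D ⊔ U)
  rw [hlow, hup]
  set N0 : ℂ := (#{Z : Submodule K V | (A ≤ Z ∧ Z ≤ D) ∧ finrank K D = finrank K Z + 1} : ℂ)
  set N1 : ℂ := (#{Z : Submodule K V | (D ⊓ U ≤ Z ∧ Z ≤ D) ∧ finrank K D = finrank K Z + 1} : ℂ)
  set M0 : ℂ := (#{Z : Submodule K V | (D ≤ Z ∧ Z ≤ ⊤) ∧ finrank K Z = finrank K D + 1} : ℂ)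
  set M1 : ℂ := (#{Z : Submodule K V | (D ≤ Z ∧ Z ≤ D ⊔ U) ∧ finrank K Z = finrank K D + 1} : ℂ)
  rw [finrank_top] at m0
  have hsup := Submodule.finrank_sup_add_finrank_inf_eq D U
  have hA := Submodule.finrank_mono (le_inf hAD hAU : A ≤ D ⊓ U)
  have hD := Submodule.finrank_mono (inf_le_left : D ⊓ U ≤ D)
  have hU := Submodule.finrank_mono (inf_le_right : D ⊓ U ≤ U)
  have hV := Submodule.finrank_le (D ⊔ U)
  generalize finrank K (D ⊓ U : Submodule K V) = a at *
  generalize finrank K (D ⊔ U : Submodule K V) = e at *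
  generalize finrank K A = r at *
  generalize finrank K D = k at *
  generalize finrank K U = j at *
  generalize finrank K V = n at *
  obtain ⟨a, rfl⟩ := Nat.exists_eq_add_of_le hA
  obtain ⟨b, rfl⟩ := Nat.exists_eq_add_of_le hD
  obtain ⟨j, rfl⟩ := Nat.exists_eq_add_of_le hU
  obtain rfl : e = r + a + b + j := by omega
  obtain ⟨c, rfl⟩ := Nat.exists_eq_add_of_le hV
  rw [show r + a + j - r = a + j by omega] at hy hx
  rw [show r + a + b - r = a + b by omega] at n0
  rw [show r + a + b - (r + a) = b by omega] at n1
  rw [show r + a + b + j - (r + a + b) = j by omega] at m1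
  rw [show r + a + b + j + c - (r + a + b) = j + c by omega] at m0
  rw [show 2 * (r + a + b + j + c) - (2 * (r + a + j) - r) = 2 * b + 2 * c + r by omega,
    show 2 * (r + a + j) - r = r + 2 * (a + j) by omega]
  have key : y⁻¹ * (N0 * x⁻¹ + N1 * (1 - x⁻¹)) + (Fintype.card K : ℂ) ^ (r + a + b + M) *
      (y * (M0 + M1 * (x - 1))) =
      (s ^ (2 * b + 2 * c + r) - s ^ (r + 2 * (a + j))) / ((Fintype.card K : ℂ) - 1) * s ^ M := by
    rw [eq_comm, div_mul_eq_mul_div, div_eq_iff hq1]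
    have expand : (y⁻¹ * (N0 * x⁻¹ + N1 * (1 - x⁻¹)) + (Fintype.card K : ℂ) ^ (r + a + b + M) *
      (y * (M0 + M1 * (x - 1)))) * ((Fintype.card K : ℂ) - 1) =
      y⁻¹ * ((Fintype.card K ^ (a + b) - 1) * x⁻¹ + (Fintype.card K ^ b - 1) * (1 - x⁻¹)) +
      (Fintype.card K : ℂ) ^ (r + a + b + M) *
      (y * ((Fintype.card K ^ (j + c) - 1) + (Fintype.card K ^ j - 1) * (x - 1))) := by
      rw [← n0, ← n1, ← m0, ← m1]
      ring
    rw [expand, hy, hx, ← hs]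
    field_simp
    ring
  linear_combination weight y x U D * key

/-- The eigenvector of the `q`-adjacency operator indexed by a linear map `g` and a subspace `U`
containing its range; `s` is a square root of the order of the field. -/
def eigenfunction (ψ : AddChar K ℂ) (s : ℂ) (g : W →ₗ[K] V) (U : Submodule K V)
    (p : V →ₗ.[K] W) : ℂ :=
  phase ψ g p * weight
    (s ^ (finrank K W + finrank K (LinearMap.range g)) *
      (Fintype.card K : ℂ) ^ (finrank K U - finrank K (LinearMap.range g)))⁻¹
    (-(Fintype.card K : ℂ) ^ (finrank K U - finrank K (LinearMap.range g))) U p.domain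

theorem sum_restrictions (w : Submodule K V → ℂ) :
    ∑ p' : V →ₗ.[K] W with p' ≤ p ∧ finrank K p.domain = finrank K p'.domain + 1,
      phase ψ g p' * w p'.domain =
    phase ψ g p * ∑ Z : Submodule K V with (LinearMap.range g ≤ Z ∧ Z ≤ p.domain) ∧
      finrank K p.domain = finrank K Z + 1, w Z := by
  have h1 : ∑ p' : V →ₗ.[K] W with p' ≤ p ∧ finrank K p.domain = finrank K p'.domain + 1,
      phase ψ g p' * w p'.domain =
      ∑ Z : Submodule K V with Z ≤ p.domain ∧ finrank K p.domain = finrank K Z + 1,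
        if LinearMap.range g ≤ Z then phase ψ g p * w Z else 0 := by
    refine Finset.sum_bij (fun p' _ => p'.domain) ?_ ?_ ?_ ?_
    · intro p' hp'
      have h := (Finset.mem_filter.1 hp').2
      exact Finset.mem_filter.2 ⟨Finset.mem_univ _, h.1.1, h.2⟩
    · intro p₁ h₁ p₂ h₂ h
      have h₁ := (Finset.mem_filter.1 h₁).2.1
      have h₂ := (Finset.mem_filter.1 h₂).2.1
      refine LinearPMap.eq_of_le_of_domain_eq ⟨h.le, fun x y hxy => ?_⟩ h
      rw [@LinearPMap.apply_comp_inclusion _ _ _ _ _ _ _ _ _ _ _ _ _ h₁ x,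
        @LinearPMap.apply_comp_inclusion _ _ _ _ _ _ _ _ _ _ _ _ _ h₂ y]
      congr 1
      exact Subtype.ext hxy
    · intro Z hZ
      have hZ := (Finset.mem_filter.1 hZ).2
      have hdom : (p.domRestrict Z).domain = Z := by
        rw [LinearPMap.domRestrict_domain]
        exact inf_eq_left.2 hZ.1
      refine ⟨p.domRestrict Z, Finset.mem_filter.2 ⟨Finset.mem_univ _,
        LinearPMap.domRestrict_le, ?_⟩, hdom⟩
      rw [hdom]
      exact hZ.2
    · intro p' hp'
      have h := (Finset.mem_filter.1 hp').2.1
      split_ifs with hg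
      · rw [phase_of_le h hg]
      · rw [phase_of_not_le hg, zero_mul]
  rw [h1, ← Finset.sum_filter, Finset.filter_filter, ← Finset.mul_sum]
  congr 2
  refine Finset.filter_congr fun Z _ => ?_
  tauto

theorem sum_extensions (hψ : ψ ≠ 1) (w : Submodule K V → ℂ) :
    ∑ p' : V →ₗ.[K] W with p ≤ p' ∧ finrank K p'.domain = finrank K p.domain + 1,
      phase ψ g p' * w p'.domain =
    phase ψ g p * ((Fintype.card K : ℂ) ^ finrank K W *
      ∑ Z : Submodule K V with (p.domain ≤ Z ∧ Z ≤ ⊤) ∧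
        finrank K Z = finrank K p.domain + 1, w Z) := by
  have hmaps : ∀ p' ∈ ({p' | p ≤ p' ∧ finrank K p'.domain = finrank K p.domain + 1} :
      Finset (V →ₗ.[K] W)), p'.domain ∈ ({Z | (p.domain ≤ Z ∧ Z ≤ ⊤) ∧
        finrank K Z = finrank K p.domain + 1} : Finset (Submodule K V)) := fun p' hp' => by
    have h := (Finset.mem_filter.1 hp').2
    exact Finset.mem_filter.2 ⟨Finset.mem_univ _, ⟨h.1.1, le_top⟩, h.2⟩
  rw [← Finset.sum_fiberwise_of_maps_to hmaps, ← mul_assoc, Finset.mul_sum]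
  refine Finset.sum_congr rfl fun Z hZ => ?_
  obtain ⟨⟨hDZ, -⟩, hdim⟩ := (Finset.mem_filter.1 hZ).2
  have hfilter : ({p' ∈ ({p' | p ≤ p' ∧ finrank K p'.domain = finrank K p.domain + 1} :
      Finset (V →ₗ.[K] W)) | p'.domain = Z}) =
      ({p' | p ≤ p' ∧ p'.domain = Z} : Finset (V →ₗ.[K] W)) := by
    rw [Finset.filter_filter]
    refine Finset.filter_congr fun p' _ => ?_
    constructor
    · exact fun h => ⟨h.1.1, h.2⟩
    · exact fun h => ⟨⟨h.1, h.2 ▸ hdim⟩, h.2⟩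
  have hw : ∑ p' : V →ₗ.[K] W with p ≤ p' ∧ p'.domain = Z, phase ψ g p' * w p'.domain =
      (∑ p' : V →ₗ.[K] W with p ≤ p' ∧ p'.domain = Z, phase ψ g p') * w Z := by
    rw [Finset.sum_mul]
    exact Finset.sum_congr rfl fun p' hp' => by rw [(Finset.mem_filter.1 hp').2.2]
  rw [hfilter, hw]
  congr 1
  by_cases hg : LinearMap.range g ≤ p.domain
  · rw [Finset.sum_congr rfl fun p' hp' => phase_of_le (Finset.mem_filter.1 hp').2.1 hg,
      Finset.sum_const, card_extension hDZ hdim, nsmul_eq_mul]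
    push_cast
    ring
  · rw [phase_of_not_le hg, zero_mul]
    by_cases hgZ : LinearMap.range g ≤ Z
    · exact sum_phase_extension_eq_zero hψ hgZ hg
    · refine Finset.sum_eq_zero fun p' hp' => phase_of_not_le ?_
      rwa [(Finset.mem_filter.1 hp').2.2]

/-- The eigenvalue equation for the `q`-adjacency operator on partial linear maps. -/
theorem sum_adjacency_eigenfunction (hψ : ψ ≠ 1) {s : ℂ} (hs : s ^ 2 = Fintype.card K)
    {U : Submodule K V} (hgU : LinearMap.range g ≤ U) (p : V →ₗ.[K] W) :
    ∑ p' : V →ₗ.[K] W,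
      (if p' ≤ p ∧ finrank K p.domain = finrank K p'.domain + 1 then (1 : ℂ)
        else if p ≤ p' ∧ finrank K p'.domain = finrank K p.domain + 1 then
          (Fintype.card K : ℂ) ^ finrank K p.domain else 0) * eigenfunction ψ s g U p' =
      (s ^ (2 * finrank K V - (2 * finrank K U - finrank K (LinearMap.range g))) -
        s ^ (2 * finrank K U - finrank K (LinearMap.range g))) / ((Fintype.card K : ℂ) - 1) *
        s ^ finrank K W * eigenfunction ψ s g U p := by
  have hsplit : ∀ p' : V →ₗ.[K] W,
      (if p' ≤ p ∧ finrank K p.domain = finrank K p'.domain + 1 then (1 : ℂ)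
        else if p ≤ p' ∧ finrank K p'.domain = finrank K p.domain + 1 then
          (Fintype.card K : ℂ) ^ finrank K p.domain else 0) * eigenfunction ψ s g U p' =
      (if p' ≤ p ∧ finrank K p.domain = finrank K p'.domain + 1 then
        eigenfunction ψ s g U p' else 0) + (Fintype.card K : ℂ) ^ finrank K p.domain *
      (if p ≤ p' ∧ finrank K p'.domain = finrank K p.domain + 1 then
        eigenfunction ψ s g U p' else 0) := by
    intro p'
    split_ifs with h1 h2 h2
    · omega
    all_goals ring
  rw [Finset.sum_congr rfl fun p' _ => hsplit p', Finset.sum_add_distrib, ← Finset.mul_sum,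
    ← Finset.sum_filter, ← Finset.sum_filter]
  simp only [eigenfunction]
  rw [sum_restrictions, sum_extensions hψ]
  by_cases hg : LinearMap.range g ≤ p.domain
  · have := weight_eigen_equation hs hgU hg (finrank K W) rfl rfl
    rw [pow_add (Fintype.card K : ℂ) (finrank K p.domain)] at this
    linear_combination phase ψ g p * this
  · simp [phase_of_not_le hg]

theorem pow_finrank_quotient_eq_sum {R : Type*} [CommRing R] [IsDomain R] [CharZero R] (x : R)
    (Y : Submodule K V) :
    x ^ finrank K (V ⧸ Y) = ∑ Z : Submodule K V with Y ≤ Z,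
      ∏ t ∈ range (finrank K (V ⧸ Z)), (x - (Fintype.card K : R) ^ t) := by
  have : Finite (V ⧸ Y) := Finite.of_surjective _ Y.mkQ_surjective
  rw [← sum_prod_sub_eq_pow (K := K) (V := V ⧸ Y) x]
  refine Finset.sum_bij (fun L _ => L.comap Y.mkQ) ?_ ?_ ?_ ?_
  · intro L _
    simpa using Submodule.le_comap_mkQ Y L
  · intro L _ L' _ h
    exact Submodule.comap_injective_of_surjective Y.mkQ_surjective h
  · intro Z hZ
    refine ⟨Z.map Y.mkQ, mem_univ _, ?_⟩
    rw [Submodule.comap_map_mkQ, sup_eq_right]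
    simpa using hZ
  · intro L _
    have h1 := finrank_comap_mkQ Y L
    have h2 := Submodule.finrank_quotient_add_finrank L
    have h3 := Submodule.finrank_quotient_add_finrank Y
    have h4 := Submodule.finrank_quotient_add_finrank (L.comap Y.mkQ)
    have : finrank K ((V ⧸ Y) ⧸ L) = finrank K (V ⧸ L.comap Y.mkQ) := by omega
    rw [this]

theorem eq_zero_of_sum_pow_finrank_inf_eq_zero {A : Submodule K V} {j J : ℕ}
    {α : Submodule K V → ℂ} (hα : ∀ U, α U ≠ 0 → A ≤ U ∧ finrank K U = j)
    (h : ∀ Z, A ≤ Z → ∑ U, α U *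
      (-(Fintype.card K : ℂ) ^ J) ^ finrank K (Z ⊓ U : Submodule K V) = 0) : α = 0 := by
  set x : ℂ := -(Fintype.card K : ℂ) ^ J with hx
  have hq : 0 < Fintype.card K := Fintype.card_pos
  have hx0 : x ≠ 0 := neg_ne_zero.2 (pow_ne_zero _ (by exact_mod_cast hq.ne'))
  set c : Submodule K V → ℂ := fun z =>
    ∏ t ∈ range (finrank K (V ⧸ z)), (x - (Fintype.card K : ℂ) ^ t) with hc
  have hc0 : ∀ z, c z ≠ 0 := fun z => prod_ne_zero_iff.2 fun t _ => by
    have : (0 : ℕ) < Fintype.card K ^ J + Fintype.card K ^ t := by positivity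
    have h' : x - (Fintype.card K : ℂ) ^ t =
        -((Fintype.card K ^ J + Fintype.card K ^ t : ℕ) : ℂ) := by
      rw [hx]; push_cast; ring
    rw [h']
    exact neg_ne_zero.2 (by exact_mod_cast this.ne')
  have hsum : ∀ Z, A ≤ Z → ∑ z with Z ≤ z, c z * ∑ U with U ≤ z, α U = 0 := fun Z hZ => by
    have h1 : ∀ U, α U * x ^ finrank K (V ⧸ (Z ⊔ U)) * x ^ (finrank K Z + j) =
        α U * x ^ finrank K (Z ⊓ U : Submodule K V) * x ^ finrank K V := fun U => by
      by_cases hU : α U = 0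
      · simp [hU]
      · have h2 := Submodule.finrank_sup_add_finrank_inf_eq Z U
        have h3 := Submodule.finrank_quotient_add_finrank (Z ⊔ U)
        rw [(hα U hU).2] at h2
        rw [mul_assoc, mul_assoc, ← pow_add, ← pow_add]
        congr 2
        omega
    have h2 : (∑ U, α U * x ^ finrank K (V ⧸ (Z ⊔ U))) * x ^ (finrank K Z + j) = 0 := by
      rw [sum_mul, sum_congr rfl fun U _ => h1 U, ← sum_mul, h Z hZ, zero_mul]
    have h3 := (mul_eq_zero.1 h2).resolve_right (pow_ne_zero _ hx0)
    rw [← h3]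
    simp_rw [pow_finrank_quotient_eq_sum, mul_sum]
    rw [sum_comm' (t' := univ) (s' := fun U => {z | Z ⊔ U ≤ z}) (by simp)]
    exact sum_congr rfl fun U _ => sum_congr rfl fun z _ => mul_comm _ _
  have hzero : ∀ z, A ≤ z → ∑ U with U ≤ z, α U = 0 := by
    intro z
    induction z using WellFoundedGT.induction with
    | ind z ih =>
      intro hz
      have h1 := hsum z hz
      rw [← Finset.add_sum_erase _ _ (a := z) (by simp)] at h1
      rw [Finset.sum_eq_zero (s := erase _ _) fun z' hz' => ?_, add_zero] at h1
      · exact (mul_eq_zero.1 h1).resolve_left (hc0 z)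
      · simp only [mem_erase, mem_filter, mem_univ, true_and] at hz'
        rw [ih z' (lt_of_le_of_ne hz'.2 hz'.1.symm) (hz.trans hz'.2), mul_zero]
  funext U₀
  by_contra hU₀
  obtain ⟨hA, hj⟩ := hα U₀ hU₀
  refine hU₀ (Eq.trans ?_ (hzero U₀ hA))
  symm
  apply Finset.sum_eq_single_of_mem U₀ (by simp)
  intro U hU hne
  by_contra hU'
  exact hne (Submodule.eq_of_le_of_finrank_eq (by simpa using hU) (by rw [(hα U hU').2, hj]))

theorem trace_addChar_injective (hψ : ψ ≠ 1) : Function.Injective fun g : W →ₗ[K] V =>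
    ψ.compAddMonoidHom ((LinearMap.trace K W).toAddMonoidHom.comp
      (LinearMap.lcomp K W g).toAddMonoidHom) := by
  intro g g' h
  by_contra hne
  have hr : ¬ LinearMap.range (g - g') ≤ ⊥ := by
    rw [le_bot_iff, LinearMap.range_eq_bot, sub_eq_zero]
    exact hne
  obtain ⟨f, -, hf⟩ := exists_addChar_trace_ne_one hψ hr
  apply hf
  have h1 : ψ (LinearMap.trace K W (f ∘ₗ g)) = ψ (LinearMap.trace K W (f ∘ₗ g')) :=
    DFunLike.congr_fun h f
  rw [LinearMap.comp_sub, map_sub, AddChar.map_sub_eq_div, h1]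
  exact div_self (ψ.val_isUnit _).ne_zero

theorem eq_zero_of_sum_trace_addChar_eq_zero (hψ : ψ ≠ 1) {β : (W →ₗ[K] V) → ℂ}
    (h : ∀ f : V →ₗ[K] W, ∑ g, ψ (LinearMap.trace K W (f ∘ₗ g)) * β g = 0) : β = 0 := by
  have h1 := (AddChar.linearIndependent (V →ₗ[K] W) ℂ).comp _ (trace_addChar_injective hψ)
  rw [Fintype.linearIndependent_iff] at h1
  funext g
  refine h1 β ?_ g
  funext f
  rw [Finset.sum_apply, Pi.zero_apply, ← h f]
  refine sum_congr rfl fun g _ => ?_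
  rw [Pi.smul_apply, smul_eq_mul, mul_comm]
  rfl

/-- Linear independence of the eigenfunctions that belong to one eigenvalue. -/
theorem eq_zero_of_sum_eigenfunction_eq_zero (hψ : ψ ≠ 1) {s : ℂ}
    (hs : s ^ 2 = Fintype.card K) {k : ℕ} {α : (W →ₗ[K] V) → Submodule K V → ℂ}
    (hα : ∀ g U, α g U ≠ 0 → LinearMap.range g ≤ U ∧
      2 * finrank K U - finrank K (LinearMap.range g) = k)
    (h : ∀ p, ∑ g, ∑ U, α g U * eigenfunction ψ s g U p = 0) : α = 0 := by
  have hq0 : (Fintype.card K : ℂ) ≠ 0 := by exact_mod_cast (Fintype.card_pos (α := K)).ne'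
  have hs0 : s ≠ 0 := fun h0 => hq0 (by rw [← hs, h0]; simp)
  have hdim : ∀ g U, α g U ≠ 0 → 2 * finrank K U = k + finrank K (LinearMap.range g) :=
    fun g U hU => by
      have := hα g U hU
      have := Submodule.finrank_mono this.1
      omega
  funext g
  set r := finrank K (LinearMap.range g) with hr
  set j := (k + r) / 2
  refine eq_zero_of_sum_pow_finrank_inf_eq_zero (A := LinearMap.range g) (j := j) (J := j - r)
    (fun U hU => ⟨(hα g U hU).1, ?_⟩) fun Z hZ => ?_
  · have := hdim g U hU
    omega
  · have h1 := eq_zero_of_sum_trace_addChar_eq_zero hψ (β := fun g =>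
      if LinearMap.range g ≤ Z then ∑ U, α g U * weight
        (s ^ (finrank K W + finrank K (LinearMap.range g)) *
          (Fintype.card K : ℂ) ^ (finrank K U - finrank K (LinearMap.range g)))⁻¹
        (-(Fintype.card K : ℂ) ^ (finrank K U - finrank K (LinearMap.range g))) U Z else 0)
      fun f => ?_
    · have h2 := congrFun h1 g
      simp only [if_pos hZ, Pi.zero_apply] at h2
      set y : ℂ := (s ^ (finrank K W + r) * (Fintype.card K : ℂ) ^ (j - r))⁻¹ with hy
      have hy0 : y ≠ 0 := inv_ne_zero (mul_ne_zero (pow_ne_zero _ hs0) (pow_ne_zero _ hq0))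
      refine (mul_eq_zero.1 (Eq.trans ?_ h2)).resolve_left (pow_ne_zero (finrank K Z) hy0)
      rw [mul_sum]
      refine sum_congr rfl fun U _ => ?_
      by_cases hU : α g U = 0
      · simp [hU]
      · have := hdim g U hU
        have hj : finrank K U = j := by omega
        rw [hj, weight, ← hr, ← hy]
        ring
    · refine Eq.trans ?_ (h (f.toPMap Z))
      refine sum_congr rfl fun g _ => ?_
      have h3 : ∀ U, eigenfunction ψ s g U (f.toPMap Z) = phase ψ g (f.toPMap Z) * weight
        (s ^ (finrank K W + finrank K (LinearMap.range g)) *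
          (Fintype.card K : ℂ) ^ (finrank K U - finrank K (LinearMap.range g)))⁻¹
        (-(Fintype.card K : ℂ) ^ (finrank K U - finrank K (LinearMap.range g))) U Z :=
        fun U => rfl
      simp_rw [h3]
      split_ifs with hg
      · rw [mul_sum]
        refine sum_congr rfl fun U _ => ?_
        rw [phase_eq (p := f.toPMap Z) hg f fun x => rfl]
        ring
      · rw [mul_zero, eq_comm]
        refine sum_eq_zero fun U _ => ?_
        rw [phase_of_not_le (p := f.toPMap Z) hg, zero_mul, mul_zero]

theorem finrank_eigenspace_eq_card {ι k E : Type*} [Fintype ι] [Field k] [AddCommGroup E]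
    [Module k E] {T : Module.End k E} (b : Basis ι k E) {a : ι → k}
    (hb : ∀ i, T (b i) = a i • b i) (μ : k) :
    finrank k (T.eigenspace μ) = Fintype.card {i // a i = μ} := by
  have hspan : T.eigenspace μ = Submodule.span k (Set.range fun i : {i // a i = μ} => b i) := by
    apply le_antisymm
    · intro x hx
      rw [Module.End.mem_eigenspace_iff] at hx
      have hrange : (Set.range fun i : {i // a i = μ} => b i) = b '' {i | a i = μ} := by
        ext; simp
      rw [hrange, Basis.mem_span_image]
      intro i hi
      have h1 : b.coord i ∘ₗ T = a i • b.coord i := b.ext fun j => by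
        rw [LinearMap.comp_apply, hb, map_smul, LinearMap.smul_apply, Basis.coord_apply,
          Basis.repr_self, Finsupp.single_apply]
        split_ifs with h
        · rw [h]
        · simp
      have h2 : μ * b.repr x i = a i * b.repr x i := by
        have := LinearMap.congr_fun h1 x
        rw [LinearMap.comp_apply, hx, map_smul] at this
        exact this
      exact (mul_right_cancel₀ (Finsupp.mem_support_iff.1 hi) h2).symm
    · rw [Submodule.span_le]
      rintro _ ⟨⟨i, rfl⟩, rfl⟩
      exact Module.End.mem_eigenspace_iff.2 (hb i)
  rw [hspan]
  exact finrank_span_eq_card (b.linearIndependent.comp _ Subtype.val_injective)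

theorem linearIndependent_of_eigenvectors {ι k E : Type*} [Fintype ι] [Field k]
    [AddCommGroup E] [Module k E] {T : Module.End k E} {v : ι → E} {a : ι → k}
    (hv : ∀ i, T (v i) = a i • v i)
    (h : ∀ μ, ∀ α : ι → k, (∀ i, α i ≠ 0 → a i = μ) → ∑ i, α i • v i = 0 → α = 0) :
    LinearIndependent k v := by
  rw [Fintype.linearIndependent_iff]
  intro α hα i
  set w : k → E := fun μ => ∑ i with a i = μ, α i • v i with hw
  have hmem : ∀ μ, w μ ∈ T.eigenspace μ := fun μ => sum_mem fun j hj =>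
    Submodule.smul_mem _ _ (Module.End.mem_eigenspace_iff.2
      ((hv j).trans (by rw [(mem_filter.1 hj).2])))
  have hsum : ∑ μ ∈ univ.image a, w μ = 0 := by
    rw [← hα]
    exact sum_fiberwise_of_maps_to (fun i _ => mem_image_of_mem a (mem_univ i)) _
  have h0 := (iSupIndep_iff_finsetSum_eq_zero_imp_eq_zero _).1 T.eigenspaces_iSupIndep
    (univ.image a) w (fun μ _ => hmem μ) hsum (a i) (mem_image_of_mem a (mem_univ i))
  have h1 := h (a i) (fun j => if a j = a i then α j else 0) (fun j hj => by
    by_contra h2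
    exact hj (if_neg h2)) (by
      rw [← h0]
      simp only [hw]
      rw [sum_filter]
      refine sum_congr rfl fun j _ => ?_
      split_ifs <;> simp)
  simpa using congrFun h1 i

theorem card_eigenindex : Fintype.card {x : (W →ₗ[K] V) × Submodule K V //
    LinearMap.range x.1 ≤ x.2} = Fintype.card (V →ₗ.[K] W) := by
  have e1 : {x : (W →ₗ[K] V) × Submodule K V // LinearMap.range x.1 ≤ x.2} ≃
      Σ U : Submodule K V, W →ₗ[K] U :=
    { toFun x := ⟨x.1.2, x.1.1.codRestrict x.1.2 fun w => x.2 ⟨w, rfl⟩⟩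
      invFun y := ⟨(y.1.subtype ∘ₗ y.2, y.1), by
        rintro _ ⟨w, rfl⟩
        exact (y.2 w).2⟩
      left_inv x := rfl
      right_inv y := rfl }
  have e2 : (V →ₗ.[K] W) ≃ Σ U : Submodule K V, U →ₗ[K] W :=
    { toFun p := ⟨p.domain, p.toFun⟩
      invFun y := ⟨y.1, y.2⟩
      left_inv p := rfl
      right_inv y := rfl }
  rw [Fintype.card_congr e1, Fintype.card_congr e2, Fintype.card_sigma, Fintype.card_sigma]
  refine sum_congr rfl fun U _ => ?_
  rw [card_linearMap, card_linearMap, mul_comm]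

theorem eigenvalue_injOn {s : ℝ} (hs : 1 < s) (c : ℝ) (hc : c ≠ 0) (n m k k' : ℕ) (hk : k ≤ n)
    (hk' : k' ≤ n)
    (h : (s ^ (n - k) - s ^ k) / c * s ^ m = (s ^ (n - k') - s ^ k') / c * s ^ m) : k = k' := by
  have hs0 : s ≠ 0 := (zero_lt_one.trans hs).ne'
  have h1 : s ^ (n - k) - s ^ k = s ^ (n - k') - s ^ k' := by
    have := mul_right_cancel₀ (pow_ne_zero m hs0) h
    field_simp at this
    exact this
  rcases lt_trichotomy k k' with hlt | heq | hgt
  · have h2 := pow_lt_pow_right₀ hs hlt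
    have h3 := pow_le_pow_right₀ hs.le (show n - k' ≤ n - k by omega)
    linarith
  · exact heq
  · have h2 := pow_lt_pow_right₀ hs hgt
    have h3 := pow_le_pow_right₀ hs.le (show n - k ≤ n - k' by omega)
    linarith

theorem finrank_eigenspace_adjacency (hψ : ψ ≠ 1) {X : Type} [Fintype X]
    (e : X ≃ (V →ₗ.[K] W)) (B : Matrix X X ℂ)
    (hB : ∀ x y, B x y =
      if e y ≤ e x ∧ finrank K (e x).domain = finrank K (e y).domain + 1 then (1 : ℂ)
        else if e x ≤ e y ∧ finrank K (e y).domain = finrank K (e x).domain + 1 then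
          (Fintype.card K : ℂ) ^ finrank K (e x).domain else 0)
    {k : ℕ} (hk : k ≤ 2 * finrank K V) :
    finrank ℂ (Module.End.eigenspace (Matrix.toLin' B)
      (theta (Fintype.card K) (finrank K V) (finrank K W) k : ℂ)) =
    Fintype.card {x : {x : (W →ₗ[K] V) × Submodule K V // LinearMap.range x.1 ≤ x.2} //
      2 * finrank K x.1.2 - finrank K (LinearMap.range x.1.1) = k} := by
  set s : ℂ := ((Real.sqrt (Fintype.card K) : ℝ) : ℂ) with hs_def
  have hs : s ^ 2 = Fintype.card K := by
    rw [hs_def, ← Complex.ofReal_pow, Real.sq_sqrt (Nat.cast_nonneg _), Complex.ofReal_natCast]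
  have hq : 1 < Fintype.card K := Fintype.one_lt_card
  have hs1 : 1 < Real.sqrt (Fintype.card K) := by
    rw [Real.lt_sqrt zero_le_one]; simpa using hq
  set ι := {x : (W →ₗ[K] V) × Submodule K V // LinearMap.range x.1 ≤ x.2}
  set κ : ι → ℕ := fun x => 2 * finrank K x.1.2 - finrank K (LinearMap.range x.1.1) with hκ
  have hκle : ∀ x, κ x ≤ 2 * finrank K V := fun x => by
    have := Submodule.finrank_le x.1.2
    simp only [hκ]
    omega
  set a : ℕ → ℂ := fun k => (theta (Fintype.card K) (finrank K V) (finrank K W) k : ℂ)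
  have ha : ∀ k k', k ≤ 2 * finrank K V → k' ≤ 2 * finrank K V → a k = a k' → k = k' :=
    fun k k' hk hk' h => eigenvalue_injOn hs1 _
      (sub_ne_zero.2 (by exact_mod_cast hq.ne')) _ _ k k' hk hk' (Complex.ofReal_injective h)
  set v : ι → X → ℂ := fun x y => eigenfunction ψ s x.1.1 x.1.2 (e y) with hv_def
  have hv : ∀ x, Matrix.toLin' B (v x) = a (κ x) • v x := fun x => by
    funext y
    rw [Matrix.toLin'_apply, Matrix.mulVec, dotProduct, Pi.smul_apply, smul_eq_mul]
    refine Eq.trans ?_ ((sum_adjacency_eigenfunction hψ hs x.2 (e y)).trans ?_)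
    · rw [← e.sum_comp]
      exact sum_congr rfl fun z _ => by rw [hB]
    · simp [a, theta, hκ, hv_def, hs_def]
  have hli : LinearIndependent ℂ v := by
    refine linearIndependent_of_eigenvectors hv fun μ α hα h => ?_
    funext x
    by_contra hx
    have hκα : ∀ y, α y ≠ 0 → κ y = κ x := fun y hy =>
      ha _ _ (hκle y) (hκle x) ((hα y hy).trans (hα x hx).symm)
    have h1 := eq_zero_of_sum_eigenfunction_eq_zero hψ hs (k := κ x)
      (α := fun g U => if hg : LinearMap.range g ≤ U then α ⟨(g, U), hg⟩ else 0)
      (fun g U hgU => by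
        by_cases hg : LinearMap.range g ≤ U
        · rw [dif_pos hg] at hgU
          exact ⟨hg, hκα _ hgU⟩
        · exact absurd (dif_neg hg) hgU) fun p => by
        rw [← Fintype.sum_prod_type', ← Finset.sum_subset (filter_subset
          (fun x : (W →ₗ[K] V) × Submodule K V => LinearMap.range x.1 ≤ x.2) univ)
          (fun x _ hx => by rw [dif_neg (by simpa using hx), zero_mul]),
          Finset.sum_subtype _ (p := fun x : (W →ₗ[K] V) × Submodule K V =>
            LinearMap.range x.1 ≤ x.2) (by simp)]
        have h2 := congrFun h (e.symm p)
        rw [Finset.sum_apply, Pi.zero_apply] at h2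
        rw [← h2]
        refine sum_congr rfl fun y _ => ?_
        simp [hv_def, y.2]
    apply hx
    have h2 := congrFun (congrFun h1 x.1.1) x.1.2
    simpa [x.2] using h2
  have hcard : Fintype.card ι = finrank ℂ (X → ℂ) := by
    rw [Module.finrank_fintype_fun_eq_card, card_eigenindex, Fintype.card_congr e]
  have : Nonempty ι := ⟨⟨(0, ⊤), le_top⟩⟩
  set b := basisOfLinearIndependentOfCardEqFinrank hli hcard with hb
  rw [show (theta (Fintype.card K) (finrank K V) (finrank K W) k : ℂ) = a k from rfl,
    finrank_eigenspace_eq_card b (a := fun x => a (κ x)) (fun x => by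
      rw [hb, coe_basisOfLinearIndependentOfCardEqFinrank, hv]) (a k)]
  refine Fintype.card_congr (Equiv.subtypeEquivRight fun x => ?_)
  exact ⟨ha _ _ (hκle x) hk, fun h => congrArg a h⟩

theorem qFact_le_qFact {q m n : ℕ} (hq : 1 < q) (h : m ≤ n) : qFact q m ≤ qFact q n := by
  induction n, h using Nat.le_induction with
  | base => exact le_rfl
  | succ n _ ih => exact ih.trans (Nat.le_mul_of_pos_left _ (qInt_pos hq n.succ_pos))

theorem qBinom_eq_zero {q n r : ℕ} (hq : 1 < q) (hr : 2 ≤ r) (h : n < r) : qBinom q n r = 0 := by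
  obtain ⟨r, rfl⟩ : ∃ t, r = t + 1 := ⟨r - 1, by omega⟩
  rw [qBinom, Nat.sub_eq_zero_of_le h.le]
  apply Nat.div_eq_of_lt
  have h1 : 1 < qInt q (r + 1) := by
    have h2 := qInt_mul_pred q (r + 1)
    have h3 : q ^ 2 ≤ q ^ (r + 1) := Nat.pow_le_pow_right (by omega) hr
    by_contra h4
    have h5 : qInt q (r + 1) * (q - 1) ≤ 1 * (q - 1) := Nat.mul_le_mul_right _ (by omega)
    have h6 : q < q ^ 2 := by nlinarith
    omega
  have h2 : qFact q n ≤ qFact q r := qFact_le_qFact hq (by omega)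
  have h3 := qFact_pos hq r
  rw [qFact, qFact, mul_one]
  nlinarith

theorem card_linearMap_finrank_range_eq_muMult (hW : 0 < finrank K W) {l : ℕ}
    (hl : 2 * l ≤ finrank K V) :
    Fintype.card {g : W →ₗ[K] V // finrank K (LinearMap.range g) = 2 * l} =
      muMult (Fintype.card K) (finrank K V) (finrank K W) (2 * l) := by
  by_cases h : 2 * l ≤ finrank K W
  · rw [card_linearMap_finrank_range_eq _ h hl, muMult]
  · rw [muMult, qBinom_eq_zero (n := finrank K W) Fintype.one_lt_card (by omega) (by omega),
      mul_zero, zero_mul, Fintype.card_eq_zero_iff]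
    refine ⟨fun g => h ?_⟩
    rw [← g.2]
    exact LinearMap.finrank_range_le _

theorem card_eigenindex_eq (hW : 0 < finrank K W) {i : ℕ} (hi : 2 * i ≤ finrank K V) :
    Fintype.card {x : {x : (W →ₗ[K] V) × Submodule K V // LinearMap.range x.1 ≤ x.2} //
      2 * finrank K x.1.2 - finrank K (LinearMap.range x.1.1) = 2 * i} =
    ∑ l ∈ range (i + 1), muMult (Fintype.card K) (finrank K V) (finrank K W) (2 * l) *
      qBinom (Fintype.card K) (finrank K V - 2 * l) (i - l) := by
  have e : {x : {x : (W →ₗ[K] V) × Submodule K V // LinearMap.range x.1 ≤ x.2} //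
      2 * finrank K x.1.2 - finrank K (LinearMap.range x.1.1) = 2 * i} ≃
      Σ g : W →ₗ[K] V, {U : Submodule K V // LinearMap.range g ≤ U ∧
        2 * finrank K U - finrank K (LinearMap.range g) = 2 * i} :=
    { toFun x := ⟨x.1.1.1, x.1.1.2, x.1.2, x.2⟩
      invFun y := ⟨⟨(y.1, y.2.1), y.2.2.1⟩, y.2.2.2⟩
      left_inv x := rfl
      right_inv y := rfl }
  have hfib : ∀ g : W →ₗ[K] V, Fintype.card {U : Submodule K V // LinearMap.range g ≤ U ∧
      2 * finrank K U - finrank K (LinearMap.range g) = 2 * i} =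
      ∑ l ∈ range (i + 1), if finrank K (LinearMap.range g) = 2 * l then
        qBinom (Fintype.card K) (finrank K V - 2 * l) (i - l) else 0 := fun g => by
    by_cases hg : ∃ l, l ≤ i ∧ finrank K (LinearMap.range g) = 2 * l
    · obtain ⟨l, hl, hgl⟩ := hg
      rw [sum_eq_single_of_mem l (by simpa [Nat.lt_succ_iff] using hl)
        (fun l' _ hne => if_neg fun h => hne (by omega)), if_pos hgl]
      have h1 := card_Icc_finrank_eq (le_top : LinearMap.range g ≤ ⊤) (i - l) (by
        rw [finrank_top, hgl]; omega)
      rw [finrank_top, hgl] at h1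
      rw [← h1]
      refine Fintype.card_congr (Equiv.subtypeEquivRight fun U => ?_)
      constructor
      · rintro ⟨h2, h3⟩
        have := Submodule.finrank_mono h2
        exact ⟨⟨h2, le_top⟩, by omega⟩
      · rintro ⟨⟨h2, -⟩, h3⟩
        exact ⟨h2, by omega⟩
    · rw [sum_eq_zero fun l hl => if_neg fun h =>
        hg ⟨l, Nat.lt_succ_iff.1 (mem_range.1 hl), h⟩, Fintype.card_eq_zero_iff]
      refine ⟨fun U => hg ⟨finrank K U - i, ?_, ?_⟩⟩
      all_goals
        have := Submodule.finrank_mono U.2.1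
        have := U.2.2
        omega
  rw [Fintype.card_congr e, Fintype.card_sigma, sum_congr rfl fun g _ => hfib g, sum_comm]
  refine sum_congr rfl fun l hl => ?_
  have hl' := mem_range.1 hl
  rw [← card_linearMap_finrank_range_eq_muMult hW (by omega), ← sum_filter, sum_const,
    smul_eq_mul, Fintype.card_subtype]

/-- Subspaces that meet `h` trivially are the graphs of the partial linear maps from a complement
of `h` to `h`. -/
def attEquiv {h C : Submodule F H} (hC : IsCompl C h) : AttX h ≃ (C →ₗ.[F] h) where
  toFun y := (y.1.comap (Submodule.prodEquivOfIsCompl C h hC).toLinearMap).toLinearPMap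
  invFun p := ⟨p.graph.map (Submodule.prodEquivOfIsCompl C h hC).toLinearMap, by
    rw [eq_bot_iff]
    rintro _ ⟨⟨⟨a, b⟩, hab, rfl⟩, hx⟩
    have ha : a = 0 := by
      have h1 : (a : H) ∈ h := by
        have := h.sub_mem hx b.2
        simpa using this
      exact Subtype.ext ((Submodule.disjoint_def.1 hC.disjoint) a a.2 h1)
    subst ha
    have hb : b = 0 := LinearPMap.graph_fst_eq_zero_snd _ hab rfl
    simp [hb]⟩
  left_inv y := by
    apply Subtype.ext
    dsimp only
    rw [Submodule.toLinearPMap_graph_eq, Submodule.map_comap_eq_of_surjective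
      (LinearEquiv.surjective _)]
    rintro ⟨a, b⟩ hab h1
    obtain rfl : a = 0 := h1
    have h2 : (b : H) ∈ y.1 ⊓ h := ⟨by simpa using hab, b.2⟩
    rw [y.2] at h2
    exact Subtype.ext h2
  right_inv p := by
    apply LinearPMap.eq_of_eq_graph
    have h1 : (p.graph.map (Submodule.prodEquivOfIsCompl C h hC).toLinearMap).comap
      (Submodule.prodEquivOfIsCompl C h hC).toLinearMap = p.graph :=
      Submodule.comap_map_eq_of_injective (LinearEquiv.injective _) _
    dsimp only
    rw [h1, Submodule.toLinearPMap_graph_eq]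
    exact fun x hx h2 => LinearPMap.graph_fst_eq_zero_snd _ hx h2

theorem attEquiv_symm_le {h C : Submodule F H} (hC : IsCompl C h) (p p' : C →ₗ.[F] h) :
    ((attEquiv hC).symm p).1 ≤ ((attEquiv hC).symm p').1 ↔ p ≤ p' := by
  rw [← LinearPMap.le_graph_iff]
  exact Submodule.map_le_map_iff_of_injective (LinearEquiv.injective _) _ _

theorem attEquiv_le {h C : Submodule F H} (hC : IsCompl C h) (y z : AttX h) :
    attEquiv hC y ≤ attEquiv hC z ↔ y.1 ≤ z.1 := by
  rw [← attEquiv_symm_le hC, Equiv.symm_apply_apply, Equiv.symm_apply_apply]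

theorem finrank_domain_attEquiv {h C : Submodule F H} (hC : IsCompl C h) (y : AttX h) :
    finrank F (attEquiv hC y).domain = vdim h y := by
  obtain ⟨p, rfl⟩ := (attEquiv hC).symm.surjective y
  rw [Equiv.apply_symm_apply, vdim]
  have h1 : finrank F ((attEquiv hC).symm p).1 = finrank F p.graph :=
    LinearEquiv.finrank_map_eq _ _
  have h2 : finrank F (p.graph.map (LinearMap.fst F C h)) = finrank F p.graph := by
    rw [← LinearMap.range_domRestrict]
    apply LinearMap.finrank_range_of_inj
    rintro ⟨x, hx⟩ ⟨x', hx'⟩ hxx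
    exact Subtype.ext (Prod.ext hxx (LinearPMap.mem_graph_snd_inj' _ hx hx' hxx))
  rw [h1, ← h2, LinearPMap.graph_map_fst_eq_domain]

end Counting

/-- for an integer `i` with `0 ≤ i ≤ N/2`, the eigenspace of `A` for
`θ_i` (encoded by the index `2i`) has dimension `∑_{ℓ=0}^{i} μ_(2ℓ) binom(N-2ℓ, i-ℓ)_q`. -/
theorem stmt14 (q N M : ℕ) (hq : Fintype.card F = q) (hN : 0 < N) (hM : 0 < M)
    (h : Submodule F H) (hH : finrank F H = N + M) (hh : finrank F h = M)
    (i : ℕ) (hi : 2 * i ≤ N) :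
    finrank ℂ (eigA h q N M (2 * i))
      = ∑ l ∈ Finset.range (i + 1), muMult q N M (2 * l) * qBinom q (N - 2 * l) (i - l) := by
  obtain ⟨C, hC'⟩ := Submodule.exists_isCompl h
  have hC := hC'.symm
  have hCN : finrank F C = N := by
    have := Submodule.finrank_add_eq_of_isCompl hC
    omega
  have : Finite C := Module.finite_of_finite F
  have : Finite h := Module.finite_of_finite F
  have hψ : (AddChar.FiniteField.primitiveChar_to_Complex F) ≠ 1 := by
    have := AddChar.FiniteField.primitiveChar_to_Complex_isPrimitive F one_ne_zero
    simpa using this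
  subst hq hh hCN
  rw [← card_eigenindex_eq hM hi, eigA]
  refine finrank_eigenspace_adjacency hψ (attEquiv hC) _ (fun y z => ?_) (by omega)
  simp only [attEquiv_le, finrank_domain_attEquiv, Amat, AttCovers]
  congr
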